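/- arXiv:2201.12112 — 8 statements merged into one kernel-verified Lean document; each statement's English description precedes it below -/
import Mathlib

section
/- Theorem 2 (quasi-isometric stiffening reaches the feasible set in finitely many steps). Suppose there exist t* ∈ (0,1) and X* ∈ E with t*·f₊(X*) < 1 (the feasible set of bounded-distortion meshes is nonempty). Let σ ∈ (0,1), t⁰ ∈ [0, t*) with t⁰·f₊(X⁰) < 1, and let sequences (X^k) in E and (t^k) in ℝ satisfy, for every k ≥ 0: (i) the QIS update rule t^{k+1} = t^k + σ·(1 − t^k·f₊(X^{k+1}))/f₊(X^{k+1}); (ii) W(X^{k+1}, t^k) ≤ W(X^k, t^k); (iii) either the essential descent condition W(X^{k+1}, t^k) ≤ (1−σ)·W(X^k, t^k), or the quasi-minimality condition inf_{Y ∈ E} W(Y, t^k) > (1−σ)·W(X^k, t^k). Then there exists a finite index K with t^K ≥ t*, and consequently f i (X^{K+1}) < 1/t* for every i ∈ ι, i.e. the feasible set of meshes with distortion below 1/t* is reached after finitely many minimization problems. -/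
open Finset

/-- The worst-element distortion `f₊(X) = max_i f i X`. -/
noncomputable def fplus {ι E : Type*} [Fintype ι] [Nonempty ι]
    (f : ι → E → ℝ) (X : E) : ℝ :=
  Finset.univ.sup' Finset.univ_nonempty (fun i => f i X)

/-- The stiffened energy `W(X,t)`, with values in `[0,∞]`: it is
`Σᵢ vᵢ · (fᵢ X)/(1 - t·fᵢ X)` when `t·f₊(X) < 1`, and `+∞` when
`t·f₊(X) ≥ 1`. -/
noncomputable def W {ι E : Type*} [Fintype ι] [Nonempty ι]
    (v : ι → ℝ) (f : ι → E → ℝ) (X : E) (t : ℝ) : ENNReal :=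
  if t * fplus f X < 1 then
    ENNReal.ofReal (∑ i, v i * (f i X / (1 - t * f i X)))
  else ⊤

section Stiffening

variable {ι E : Type*} [Fintype ι] [Nonempty ι]

lemma le_fplus (f : ι → E → ℝ) (i : ι) (X : E) : f i X ≤ fplus f X :=
  Finset.le_sup' (fun i => f i X) (Finset.mem_univ i)

lemma exists_eq_fplus (f : ι → E → ℝ) (X : E) : ∃ j, fplus f X = f j X := by
  obtain ⟨j, -, hj⟩ := Finset.exists_mem_eq_sup' Finset.univ_nonempty (fun i => f i X)
  exact ⟨j, hj⟩

lemma one_le_fplus {f : ι → E → ℝ} (hf : ∀ i X, 1 ≤ f i X) (X : E) : 1 ≤ fplus f X :=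
  (hf (Classical.arbitrary ι) X).trans (le_fplus f _ X)

lemma one_sub_mul_pos {f : ι → E → ℝ} {X : E} {t : ℝ} (ht : 0 ≤ t)
    (h : t * fplus f X < 1) (i : ι) : 0 < 1 - t * f i X := by
  nlinarith [mul_le_mul_of_nonneg_left (le_fplus f i X) ht]

/-- The real-valued stiffened energy, meaningful on the domain `t * f₊(X) < 1`. -/
noncomputable def realEnergy (v : ι → ℝ) (f : ι → E → ℝ) (X : E) (t : ℝ) : ℝ :=
  ∑ i, v i * (f i X / (1 - t * f i X))

lemma W_eq_ofReal (v : ι → ℝ) {f : ι → E → ℝ} {X : E} {t : ℝ} (h : t * fplus f X < 1) :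
    W v f X t = ENNReal.ofReal (realEnergy v f X t) :=
  if_pos h

lemma lt_one_of_W_ne_top {v : ι → ℝ} {f : ι → E → ℝ} {X : E} {t : ℝ} (h : W v f X t ≠ ⊤) :
    t * fplus f X < 1 := by
  by_contra hn
  exact h (if_neg hn)

lemma realEnergy_term_nonneg {v : ι → ℝ} (hv : ∀ i, 0 < v i) {f : ι → E → ℝ}
    (hf : ∀ i X, 1 ≤ f i X) {X : E} {t : ℝ} (ht : 0 ≤ t) (h : t * fplus f X < 1) (i : ι) :
    0 ≤ v i * (f i X / (1 - t * f i X)) :=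
  mul_nonneg (hv i).le
    (div_nonneg (zero_le_one.trans (hf i X)) (one_sub_mul_pos ht h i).le)

lemma realEnergy_nonneg {v : ι → ℝ} (hv : ∀ i, 0 < v i) {f : ι → E → ℝ}
    (hf : ∀ i X, 1 ≤ f i X) {X : E} {t : ℝ} (ht : 0 ≤ t) (h : t * fplus f X < 1) :
    0 ≤ realEnergy v f X t :=
  Finset.sum_nonneg fun i _ => realEnergy_term_nonneg hv hf ht h i

lemma realEnergy_mono {v : ι → ℝ} (hv : ∀ i, 0 < v i) {f : ι → E → ℝ}
    (hf : ∀ i X, 1 ≤ f i X) {X : E} {s t : ℝ} (ht : 0 ≤ t) (hst : s ≤ t)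
    (h : t * fplus f X < 1) : realEnergy v f X s ≤ realEnergy v f X t := by
  refine Finset.sum_le_sum fun i _ => mul_le_mul_of_nonneg_left ?_ (hv i).le
  have hi : 0 ≤ f i X := zero_le_one.trans (hf i X)
  exact div_le_div_of_nonneg_left hi (one_sub_mul_pos ht h i)
    (by linarith [mul_le_mul_of_nonneg_right hst hi])

/-- The worst element bounds the energy from below. -/
lemma mul_fplus_le_realEnergy {v : ι → ℝ} (hv : ∀ i, 0 < v i) {f : ι → E → ℝ}
    (hf : ∀ i X, 1 ≤ f i X) {c : ℝ} (hc : ∀ i, c ≤ v i) {X : E} {t : ℝ} (ht : 0 ≤ t)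
    (h : t * fplus f X < 1) :
    c * fplus f X ≤ realEnergy v f X t * (1 - t * fplus f X) := by
  obtain ⟨j, hj⟩ := exists_eq_fplus f X
  have hj0 : 0 ≤ f j X := zero_le_one.trans (hf j X)
  have hpos := one_sub_mul_pos ht h j
  have hle : v j * (f j X / (1 - t * f j X)) ≤ realEnergy v f X t :=
    Finset.single_le_sum (f := fun i => v i * (f i X / (1 - t * f i X)))
      (fun i _ => realEnergy_term_nonneg hv hf ht h i) (Finset.mem_univ j)
  rw [hj]
  calc c * f j X ≤ v j * f j X := mul_le_mul_of_nonneg_right (hc j) hj0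
    _ = v j * (f j X / (1 - t * f j X)) * (1 - t * f j X) := by
        rw [mul_assoc, div_mul_cancel₀ _ hpos.ne']
    _ ≤ _ := mul_le_mul_of_nonneg_right hle hpos.le

/-- One update of the stiffening parameter multiplies the energy by at most `1 / (1 - σ)`. -/
lemma realEnergy_update_le {v : ι → ℝ} (hv : ∀ i, 0 < v i) {f : ι → E → ℝ}
    (hf : ∀ i X, 1 ≤ f i X) {X : E} {σ s t : ℝ} (hσ : σ ∈ Set.Ioo (0 : ℝ) 1) (ht : 0 ≤ t)
    (h : t * fplus f X < 1) (hs : s = t + σ * (1 - t * fplus f X) / fplus f X) :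
    (1 - σ) * realEnergy v f X s ≤ realEnergy v f X t := by
  rw [realEnergy, realEnergy, Finset.mul_sum]
  refine Finset.sum_le_sum fun i _ => ?_
  have hF : 0 < fplus f X := zero_lt_one.trans_le (one_le_fplus hf X)
  have hi : 0 < f i X := zero_lt_one.trans_le (hf i X)
  have hpos := one_sub_mul_pos ht h i
  have hσ' : 0 < 1 - σ := sub_pos.2 hσ.2
  have hle : σ * (1 - t * fplus f X) / fplus f X * f i X ≤ σ * (1 - t * f i X) := by
    have h1 : σ * (1 - t * fplus f X) / fplus f X * f i X ≤ σ * (1 - t * fplus f X) := by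
      rw [div_mul_eq_mul_div, div_le_iff₀ hF]
      exact mul_le_mul_of_nonneg_left (le_fplus f i X)
        (mul_nonneg hσ.1.le (sub_pos.2 h).le)
    have h2 := mul_le_mul_of_nonneg_left (le_fplus f i X) ht
    exact h1.trans (mul_le_mul_of_nonneg_left (by linarith) hσ.1.le)
  have hden : (1 - σ) * (1 - t * f i X) ≤ 1 - s * f i X := by
    rw [hs]; linarith
  have hkey : f i X / (1 - s * f i X) ≤ f i X / ((1 - σ) * (1 - t * f i X)) :=
    div_le_div_of_nonneg_left hi.le (mul_pos hσ' hpos) hden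
  calc (1 - σ) * (v i * (f i X / (1 - s * f i X)))
      ≤ (1 - σ) * (v i * (f i X / ((1 - σ) * (1 - t * f i X)))) :=
        mul_le_mul_of_nonneg_left (mul_le_mul_of_nonneg_left hkey (hv i).le) hσ'.le
    _ = v i * (f i X / (1 - t * f i X)) := by field_simp

end Stiffening

/-- Theorem 2: quasi-isometric stiffening reaches the feasible set of
bounded-distortion meshes in finitely many minimization problems. -/
theorem qis_reaches_feasible_set
    {ι E : Type*} [Fintype ι] [Nonempty ι]
    (v : ι → ℝ) (hv : ∀ i, 0 < v i)
    (f : ι → E → ℝ) (hf : ∀ i X, 1 ≤ f i X)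
    (tstar : ℝ) (htstar : tstar ∈ Set.Ioo (0:ℝ) 1)
    (Xstar : E) (hfeas : tstar * fplus f Xstar < 1)
    (σ : ℝ) (hσ : σ ∈ Set.Ioo (0:ℝ) 1)
    (X : ℕ → E) (t : ℕ → ℝ)
    (ht0 : 0 ≤ t 0) (ht0' : t 0 < tstar)
    (ht0f : t 0 * fplus f (X 0) < 1)
    (hupd : ∀ k, t (k + 1) =
      t k + σ * (1 - t k * fplus f (X (k + 1))) / fplus f (X (k + 1)))
    (hmono : ∀ k, W v f (X (k + 1)) (t k) ≤ W v f (X k) (t k))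
    (halt : ∀ k,
      W v f (X (k + 1)) (t k) ≤ ENNReal.ofReal (1 - σ) * W v f (X k) (t k) ∨
      (⨅ Y : E, W v f Y (t k)) > ENNReal.ofReal (1 - σ) * W v f (X k) (t k)) :
    ∃ K : ℕ, tstar ≤ t K ∧ ∀ i, f i (X (K + 1)) < 1 / tstar := by
  have hσ' : 0 < 1 - σ := sub_pos.2 hσ.2
  have hFpos : ∀ Y, 0 < fplus f Y := fun Y => zero_lt_one.trans_le (one_le_fplus hf Y)
  have hnext : ∀ k, t k * fplus f (X k) < 1 → t k * fplus f (X (k + 1)) < 1 := by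
    intro k hk
    refine lt_one_of_W_ne_top (ne_top_of_le_ne_top ?_ (hmono k))
    rw [W_eq_ofReal v hk]
    exact ENNReal.ofReal_ne_top
  have hinv : ∀ k, 0 ≤ t k ∧ t k * fplus f (X k) < 1 := by
    intro k
    induction k with
    | zero => exact ⟨ht0, ht0f⟩
    | succ k ih =>
      have hF := hFpos (X (k + 1))
      have h1 := hnext k ih.2
      constructor
      · rw [hupd k]
        exact add_nonneg ih.1
          (div_nonneg (mul_nonneg hσ.1.le (sub_pos.2 h1).le) hF.le)
      · have : t (k + 1) * fplus f (X (k + 1)) =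
            t k * fplus f (X (k + 1)) + σ * (1 - t k * fplus f (X (k + 1))) := by
          rw [hupd k]; field_simp
        nlinarith [mul_pos hσ' (sub_pos.2 h1)]
  have hfeasNext : ∀ k, t k * fplus f (X (k + 1)) < 1 := fun k => hnext k (hinv k).2
  suffices h : ∃ K, tstar ≤ t K by
    obtain ⟨K, hK⟩ := h
    refine ⟨K, hK, fun i => ?_⟩
    rw [lt_div_iff₀ htstar.1]
    have hi : 0 ≤ f i (X (K + 1)) := zero_le_one.trans (hf i _)
    nlinarith [one_sub_mul_pos (hinv K).1 (hfeasNext K) i, mul_le_mul_of_nonneg_right hK hi]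
  by_contra! hlt
  set C := realEnergy v f Xstar tstar
  have hdesc : ∀ k, realEnergy v f (X (k + 1)) (t k) ≤ realEnergy v f (X k) (t k) := by
    intro k
    have h := hmono k
    rw [W_eq_ofReal v (hfeasNext k), W_eq_ofReal v (hinv k).2] at h
    exact (ENNReal.ofReal_le_ofReal_iff (realEnergy_nonneg hv hf (hinv k).1 (hinv k).2)).1 h
  have hcases : ∀ k,
      realEnergy v f (X (k + 1)) (t k) ≤ (1 - σ) * realEnergy v f (X k) (t k) ∨
      (1 - σ) * realEnergy v f (X k) (t k) ≤ C := by
    intro k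
    have hS := realEnergy_nonneg hv hf (hinv k).1 (hinv k).2
    refine (halt k).imp (fun h => ?_) (fun h => ?_)
    · rw [W_eq_ofReal v (hfeasNext k), W_eq_ofReal v (hinv k).2,
        ← ENNReal.ofReal_mul hσ'.le] at h
      exact (ENNReal.ofReal_le_ofReal_iff (mul_nonneg hσ'.le hS)).1 h
    · have hstar : t k * fplus f Xstar < 1 :=
        (mul_le_mul_of_nonneg_right (hlt k).le (hFpos Xstar).le).trans_lt hfeas
      have h' := h.lt.trans_le (iInf_le _ Xstar)
      rw [W_eq_ofReal v hstar, W_eq_ofReal v (hinv k).2, ← ENNReal.ofReal_mul hσ'.le] at h'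
      exact (ENNReal.ofReal_lt_ofReal_iff'.1 h').1.le.trans
        (realEnergy_mono hv hf htstar.1.le (hlt k).le hfeas)
  obtain ⟨M, hMpos, hM0, hMC⟩ :
      ∃ M, 0 < M ∧ realEnergy v f (X 0) (t 0) ≤ M ∧ C ≤ (1 - σ) * ((1 - σ) * M) := by
    refine ⟨max 1 (max (realEnergy v f (X 0) (t 0)) (C / ((1 - σ) * (1 - σ)))),
      zero_lt_one.trans_le (le_max_left _ _), (le_max_left _ _).trans (le_max_right _ _), ?_⟩
    rw [← mul_assoc, ← div_le_iff₀' (mul_pos hσ' hσ')]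
    exact (le_max_right _ _).trans (le_max_right _ _)
  have hbound : ∀ k, realEnergy v f (X k) (t k) ≤ M := by
    intro k
    induction k with
    | zero => exact hM0
    | succ k ih =>
      have hup := realEnergy_update_le hv hf hσ (hinv k).1 (hfeasNext k) (hupd k)
      refine le_of_mul_le_mul_left (hup.trans ?_) hσ'
      rcases hcases k with h | h
      · exact h.trans (mul_le_mul_of_nonneg_left ih hσ'.le)
      · exact (hdesc k).trans (le_of_mul_le_mul_left (h.trans hMC) hσ')
  obtain ⟨j, hj⟩ := Finite.exists_min v
  have hstep : ∀ k, t k + σ * (v j / M) ≤ t (k + 1) := by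
    intro k
    rw [hupd k, mul_div_assoc]
    refine add_le_add_right (mul_le_mul_of_nonneg_left ?_ hσ.1.le) _
    rw [div_le_div_iff₀ hMpos (hFpos _), mul_comm (1 - _) M]
    exact (mul_fplus_le_realEnergy hv hf hj (hinv k).1 (hfeasNext k)).trans
      (mul_le_mul_of_nonneg_right ((hdesc k).trans (hbound k)) (sub_pos.2 (hfeasNext k)).le)
  have hgrow : ∀ k : ℕ, k * (σ * (v j / M)) ≤ t k := by
    intro k
    induction k with
    | zero => simpa using ht0
    | succ k ih =>
      push_cast
      linarith [hstep k]
  obtain ⟨n, hn⟩ := exists_nat_gt (tstar / (σ * (v j / M)))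
  rw [div_lt_iff₀ (mul_pos hσ.1 (div_pos (hv j) hMpos))] at hn
  linarith [hgrow n, hlt n]
end

section
/- Key stiffening inequality (Eq. (f_bounded)). Let f : ι → ℝ satisfy f i ≥ 1 for all i, let v i > 0, write f₊ := max_i f i, and let t ≥ 0 with t·f₊ < 1 and σ ∈ (0,1). Set t' := t + σ·(1 − t·f₊)/f₊. Then: (a) 1 − t'·f₊ = (1−σ)·(1 − t·f₊) > 0, so in particular t'·f i < 1 for every i; and (b) (1−σ)·Σ_{i∈ι} v i · (f i)/(1 − t'·f i) ≤ Σ_{i∈ι} v i · (f i)/(1 − t·f i). -/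
open Finset

/-- Key stiffening inequality (Eq. (f_bounded)). -/
theorem key_stiffening_inequality
    {ι : Type*} [Fintype ι] [Nonempty ι]
    (v f : ι → ℝ) (hv : ∀ i, 0 < v i) (hf : ∀ i, 1 ≤ f i)
    (fp : ℝ) (hfp : fp = Finset.univ.sup' Finset.univ_nonempty f)
    (t σ : ℝ) (ht : 0 ≤ t) (htf : t * fp < 1) (hσ : σ ∈ Set.Ioo (0:ℝ) 1)
    (t' : ℝ) (ht' : t' = t + σ * (1 - t * fp) / fp) :
    (1 - t' * fp = (1 - σ) * (1 - t * fp) ∧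
      0 < (1 - σ) * (1 - t * fp) ∧
      ∀ i, t' * f i < 1) ∧
    (1 - σ) * ∑ i, v i * (f i / (1 - t' * f i)) ≤ ∑ i, v i * (f i / (1 - t * f i)) := by
  obtain ⟨hσ0, hσ1⟩ := hσ
  have hle : ∀ i, f i ≤ fp := fun i => hfp ▸ Finset.le_sup' f (Finset.mem_univ i)
  have hfp0 : 0 < fp :=
    (zero_lt_one.trans_le (hf (Classical.arbitrary ι))).trans_le (hle _)
  have hpos : 0 < (1 - σ) * (1 - t * fp) := mul_pos (by linarith) (by linarith)
  have htf_pos : ∀ i, 0 < 1 - t * f i := fun i => by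
    linarith [mul_le_mul_of_nonneg_left (hle i) ht]
  have hden : ∀ i, (1 - σ) * (1 - t * f i) ≤ 1 - t' * f i := fun i => by
    have h : t' * f i = t * f i + σ * (f i / fp - t * f i) := by
      rw [ht']
      field_simp
    have h1 : f i / fp ≤ 1 := (div_le_one hfp0).2 (hle i)
    linarith [mul_le_mul_of_nonneg_left h1 hσ0.le]
  have hden_pos : ∀ i, 0 < (1 - σ) * (1 - t * f i) := fun i =>
    mul_pos (by linarith) (htf_pos i)
  refine ⟨⟨?_, hpos, fun i => by linarith [hden i, hden_pos i]⟩, ?_⟩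
  · rw [ht']
    field_simp
    ring
  · rw [Finset.mul_sum]
    refine Finset.sum_le_sum fun i _ => ?_
    rw [mul_left_comm]
    refine mul_le_mul_of_nonneg_left ?_ (hv i).le
    have hfi : 0 ≤ f i := zero_le_one.trans (hf i)
    rw [← mul_div_assoc, div_le_div_iff₀ ((hden_pos i).trans_le (hden i)) (htf_pos i)]
    linarith [mul_le_mul_of_nonneg_left (hden i) hfi]
end

section
/- Descent case of the stiffening iteration. Let f, g : ι → ℝ satisfy f i ≥ 1 and g i ≥ 1 for all i (distortions of X^k and X^{k+1} respectively), v i > 0, σ ∈ (0,1), t ≥ 0 with t·max_i f i < 1 and t·max_i g i < 1. Set t' := t + σ·(1 − t·g₊)/g₊ where g₊ := max_i g i. If the essential descent condition W(g,t) ≤ (1−σ)·W(f,t) holds, then W(g,t') ≤ W(f,t); i.e. the stiffened energy does not increase across one QIS step in the descent case. -/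
open Finset

/-- Moving `t` a fraction `σ` of the way towards `1 / m` multiplies `1 - t * x` by
at least `1 - σ`, for every `x ≤ m`. -/
theorem one_sub_mul_le_one_sub_step_mul {σ t m x : ℝ} (hσ : 0 ≤ σ) (hm : 0 < m) (hx : x ≤ m) :
    (1 - σ) * (1 - t * x) ≤ 1 - (t + σ * (1 - t * m) / m) * x := by
  have hxm : x / m ≤ 1 := (div_le_one hm).2 hx
  have key : 1 - (t + σ * (1 - t * m) / m) * x - (1 - σ) * (1 - t * x) = σ * (1 - x / m) := by
    field_simp
    ring
  have : 0 ≤ σ * (1 - x / m) := mul_nonneg hσ (by linarith)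
  linarith

/-- Descent case of the stiffening iteration: under the essential descent
condition `W(g,t) ≤ (1-σ)·W(f,t)`, the stiffened energy does not increase
across one QIS step. -/
theorem descent_case
    {ι : Type*} [Fintype ι] [Nonempty ι]
    (v f g : ι → ℝ) (hv : ∀ i, 0 < v i) (hf : ∀ i, 1 ≤ f i) (hg : ∀ i, 1 ≤ g i)
    (σ : ℝ) (hσ : σ ∈ Set.Ioo (0:ℝ) 1)
    (t : ℝ) (ht : 0 ≤ t)
    (htf : t * Finset.univ.sup' Finset.univ_nonempty f < 1)
    (gp : ℝ) (hgp : gp = Finset.univ.sup' Finset.univ_nonempty g)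
    (htg : t * gp < 1)
    (t' : ℝ) (ht' : t' = t + σ * (1 - t * gp) / gp)
    (hdesc : ∑ i, v i * (g i / (1 - t * g i)) ≤ (1 - σ) * ∑ i, v i * (f i / (1 - t * f i))) :
    ∑ i, v i * (g i / (1 - t' * g i)) ≤ ∑ i, v i * (f i / (1 - t * f i)) := by
  obtain ⟨hσ0, hσ1⟩ := hσ
  have hs : 0 < 1 - σ := by linarith
  have hle : ∀ i, g i ≤ gp := fun i => hgp ▸ Finset.le_sup' g (Finset.mem_univ i)
  have hgp0 : 0 < gp := by
    obtain ⟨i⟩ := ‹Nonempty ι›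
    linarith [hg i, hle i]
  refine le_of_mul_le_mul_left (le_trans ?_ hdesc) hs
  rw [Finset.mul_sum]
  refine Finset.sum_le_sum fun i _ => ?_
  rw [mul_left_comm]
  refine mul_le_mul_of_nonneg_left ?_ (hv i).le
  have hpos : 0 < 1 - t * g i := by
    linarith [mul_le_mul_of_nonneg_left (hle i) ht]
  have hstep : (1 - σ) * (1 - t * g i) ≤ 1 - t' * g i :=
    ht' ▸ one_sub_mul_le_one_sub_step_mul hσ0.le hgp0 (hle i)
  have hpos' : 0 < 1 - t' * g i := (mul_pos hs hpos).trans_le hstep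
  rw [← mul_div_assoc, div_le_div_iff₀ hpos' hpos]
  calc (1 - σ) * g i * (1 - t * g i) = g i * ((1 - σ) * (1 - t * g i)) := by ring
    _ ≤ g i * (1 - t' * g i) := mul_le_mul_of_nonneg_left hstep (by linarith [hg i])
end

section
/- Degeneration of the distortion gap along a non-terminating QIS iteration. Let σ ∈ (0,1), t* < 1, t⁰ ≥ 0, and let (t^k)_{k≥0}, (φ^k)_{k≥1} be real sequences with φ^{k+1} ≥ 1, t^k·φ^{k+1} < 1, and t^{k+1} = t^k + σ·(1 − t^k·φ^{k+1})/φ^{k+1} for all k ≥ 0. If t^k < t* for all k, then the sequence (1 − t^k·φ^{k+1}) tends to 0 (from above) as k → ∞. -/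
open Filter

/-- Degeneration of the distortion gap along a non-terminating QIS iteration:
the gap `1 - t^k·φ^{k+1}` tends to `0` from above as `k → ∞`. -/
theorem qis_gap_degenerates
    (σ : ℝ) (hσ : σ ∈ Set.Ioo (0:ℝ) 1)
    (tstar : ℝ) (htstar : tstar < 1)
    (t : ℕ → ℝ) (ht0 : 0 ≤ t 0)
    (φ : ℕ → ℝ)
    (hφ : ∀ k, 1 ≤ φ (k + 1))
    (hgap : ∀ k, t k * φ (k + 1) < 1)
    (hupd : ∀ k, t (k + 1) = t k + σ * (1 - t k * φ (k + 1)) / φ (k + 1))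
    (hbelow : ∀ k, t k < tstar) :
    Tendsto (fun k => 1 - t k * φ (k + 1)) atTop (nhdsWithin 0 (Set.Ioi 0)) := by
  have hσ0 : 0 < σ := hσ.1
  have hφ_pos : ∀ k, 0 < φ (k + 1) := fun k => one_pos.trans_le (hφ k)
  have hgap_pos : ∀ k, 0 < 1 - t k * φ (k + 1) := fun k => sub_pos.2 (hgap k)
  have hinc : ∀ k, 0 < σ * (1 - t k * φ (k + 1)) / φ (k + 1) := fun k =>
    div_pos (mul_pos hσ0 (hgap_pos k)) (hφ_pos k)
  have hmono : Monotone t := monotone_nat_of_le_succ fun k => by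
    linarith [hupd k, hinc k]
  have ht1 : 0 < t 1 := by
    linarith [hupd 0, hinc 0]
  have hlim : Tendsto t atTop (nhds (⨆ k, t k)) :=
    tendsto_atTop_ciSup hmono ⟨tstar, by rintro _ ⟨k, rfl⟩; exact (hbelow k).le⟩
  have hdiff : Tendsto (fun k => (t (k + 1) - t k) / (σ * t 1)) atTop (nhds 0) := by
    simpa using ((hlim.comp (tendsto_add_atTop_nat 1)).sub hlim).div_const (σ * t 1)
  refine tendsto_nhdsWithin_iff.2 ⟨?_, Eventually.of_forall hgap_pos⟩
  refine squeeze_zero' (Eventually.of_forall fun k => (hgap_pos k).le) ?_ hdiff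
  filter_upwards [eventually_ge_atTop 1] with k hk
  have hφ_bound : t 1 * φ (k + 1) ≤ 1 :=
    (mul_le_mul_of_nonneg_right (hmono hk) (hφ_pos k).le).trans (hgap k).le
  have hstep : t (k + 1) - t k = σ * (1 - t k * φ (k + 1)) / φ (k + 1) := by
    linarith [hupd k]
  rw [hstep, le_div_iff₀ (mul_pos hσ0 ht1), le_div_iff₀ (hφ_pos k)]
  nlinarith [mul_le_mul_of_nonneg_left hφ_bound (mul_pos hσ0 (hgap_pos k)).le]
end

section
/- Reshetnyak-type inequality. Let d ≥ 2, let σ₁ ≥ σ₂ ≥ … ≥ σ_d > 0 be real numbers (the ordered singular values of a Jacobian matrix), and let c ≥ 1. If ((1/d)·Σ_{j=1}^d σ_j²)^{d/2} / (Π_{j=1}^d σ_j) < c, then σ₁/σ_d < c + √(c² − 1). -/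
open Finset

/-- The inequality of arithmetic and geometric means over `Fin n`, without roots. -/
theorem prod_le_arith_mean_pow {n : ℕ} (hn : n ≠ 0) (z : Fin n → ℝ) (hz : ∀ i, 0 ≤ z i) :
    ∏ i, z i ≤ ((1 / (n : ℝ)) * ∑ i, z i) ^ n := by
  have hn' : (n : ℝ) ≠ 0 := by exact_mod_cast hn
  have key := Real.geom_mean_le_arith_mean_weighted univ (fun _ => 1 / (n : ℝ)) z
    (fun _ _ => by positivity) (by simp [hn']) (fun i _ => hz i)
  rw [Real.finsetProd_rpow _ _ (fun i _ => hz i), ← mul_sum] at key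
  have hp : 0 ≤ ∏ i, z i := prod_nonneg fun i _ => hz i
  calc ∏ i, z i = ((∏ i, z i) ^ (1 / (n : ℝ))) ^ n := by
        rw [one_div, Real.rpow_inv_natCast_pow hp hn]
    _ ≤ _ := pow_le_pow_left₀ (by positivity) key n

/-- The mean of `a ^ 2` and `b ^ 2` times the product of the `q i` is at most the mean of the
squares of all these entries, raised to half their number. -/
theorem mul_prod_le_sq_mean_rpow {n : ℕ} (a b : ℝ) (q : Fin n → ℝ) :
    (a ^ 2 + b ^ 2) / 2 * ∏ i, q i ≤
      ((1 / ((n + 2 : ℕ) : ℝ)) * (a ^ 2 + (∑ i, q i ^ 2 + b ^ 2))) ^ (((n + 2 : ℕ) : ℝ) / 2) := by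
  set m := (a ^ 2 + b ^ 2) / 2 with hm
  have hm0 : 0 ≤ m := by positivity
  set M := (1 / ((n + 2 : ℕ) : ℝ)) * (a ^ 2 + (∑ i, q i ^ 2 + b ^ 2)) with hM
  have hM0 : 0 ≤ M := by
    have : 0 ≤ ∑ i, q i ^ 2 := sum_nonneg fun i _ => sq_nonneg _
    positivity
  have key := prod_le_arith_mean_pow (n := n + 2) (by omega)
    (Fin.cons m (Fin.snoc (fun i => q i ^ 2) m : Fin (n + 1) → ℝ)) (by
      intro i
      refine Fin.cases hm0 (fun i => ?_) i
      refine Fin.lastCases ?_ (fun i => ?_) i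
      · simpa using hm0
      · simpa using sq_nonneg (q i))
  rw [Fin.prod_univ_succ, Fin.sum_univ_succ] at key
  simp only [Fin.cons_zero, Fin.cons_succ, Fin.prod_univ_castSucc, Fin.sum_univ_castSucc,
    Fin.snoc_castSucc, Fin.snoc_last, prod_pow] at key
  have hsum : m + (∑ i, q i ^ 2 + m) = a ^ 2 + (∑ i, q i ^ 2 + b ^ 2) := by
    rw [hm]; ring
  rw [hsum, ← hM] at key
  refine (abs_le_of_sq_le_sq' ?_ (Real.rpow_nonneg hM0 _)).2
  rw [← Real.rpow_natCast (M ^ _) 2, ← Real.rpow_mul hM0, Nat.cast_ofNat,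
    div_mul_cancel₀ _ two_ne_zero, Real.rpow_natCast]
  linarith

/-- If `t` satisfies `t ^ 2 + 1 < 2 * c * t`, then `t` lies below the larger root of the
corresponding quadratic. -/
theorem lt_add_sqrt_of_sq_add_one_lt {t c : ℝ} (h : t ^ 2 + 1 < 2 * c * t) :
    t < c + Real.sqrt (c ^ 2 - 1) := by
  have : t - c < Real.sqrt (c ^ 2 - 1) := Real.lt_sqrt_of_sq_lt (by linarith [sub_sq t c])
  linarith

/-- Reshetnyak-type inequality: a bound on `((1/d)·Σσⱼ²)^{d/2}/Πσⱼ` controls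
the ratio of extreme singular values. -/
theorem reshetnyak_inequality
    {d : ℕ} (hd : 2 ≤ d)
    (σ : Fin d → ℝ) (hpos : ∀ j, 0 < σ j)
    (hord : ∀ i j : Fin d, i ≤ j → σ j ≤ σ i)
    (c : ℝ) (hc : 1 ≤ c)
    (h : ((1 / (d:ℝ)) * ∑ j, σ j ^ 2) ^ ((d:ℝ) / 2) / ∏ j, σ j < c) :
    σ ⟨0, by omega⟩ / σ ⟨d - 1, by omega⟩ < c + Real.sqrt (c ^ 2 - 1) := by
  obtain ⟨n, rfl⟩ : ∃ n, d = n + 2 := ⟨d - 2, by omega⟩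
  change σ 0 / σ (Fin.last (n + 1)) < _
  have ha := hpos 0
  have hb := hpos (Fin.last (n + 1))
  have key := mul_prod_le_sq_mean_rpow (σ 0) (σ (Fin.last (n + 1)))
    (fun i : Fin n => σ i.castSucc.succ)
  have hP : 0 < ∏ i : Fin n, σ i.castSucc.succ := prod_pos fun i _ => hpos _
  rw [div_lt_iff₀ (prod_pos fun i _ => hpos i), Fin.sum_univ_succ, Fin.prod_univ_succ,
    Fin.sum_univ_castSucc, Fin.prod_univ_castSucc, Fin.succ_last] at h
  have hlt := key.trans_lt h
  have hab : (σ 0 ^ 2 + σ (Fin.last (n + 1)) ^ 2) / 2 < c * (σ 0 * σ (Fin.last (n + 1))) := by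
    refine lt_of_mul_lt_mul_right (hlt.trans_eq ?_) hP.le
    ring
  apply lt_add_sqrt_of_sq_add_one_lt
  rw [div_pow, div_add_one (by positivity), div_lt_iff₀ (by positivity)]
  field_simp
  linarith
end

section
/- Quasi-isometry bound from condition-number and volume bounds. Let d ≥ 1 and let σ₁ ≥ σ₂ ≥ … ≥ σ_d > 0 be real numbers. Suppose σ₁/σ_d ≤ a with a ≥ 1, and (P + 1/P)/2 ≤ c₂ where P := Π_{j=1}^d σ_j and c₂ ≥ 1. Set Γ := a^{(d−1)/d} · (c₂ + √(c₂² − 1))^{1/d}. Then 1/Γ ≤ σ_j ≤ Γ for every j = 1, …, d. -/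
open Finset

theorem le_add_sqrt_of_add_inv_le {P c : ℝ} (hP : 0 < P) (h : (P + P⁻¹) / 2 ≤ c) :
    P ≤ c + Real.sqrt (c ^ 2 - 1) := by
  have hmul : P * P⁻¹ = 1 := mul_inv_cancel₀ hP.ne'
  have hsq : (P - c) ^ 2 ≤ c ^ 2 - 1 := by nlinarith
  linarith [(abs_le.mp (Real.abs_le_sqrt hsq)).2]

theorem pow_card_le_of_ratio_le {ι : Type*} [Fintype ι] {s : ι → ℝ} {a : ℝ}
    (hs : ∀ i, 0 < s i) (h : ∀ i j, s i ≤ a * s j) (j : ι) :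
    s j ^ Fintype.card ι ≤ a ^ (Fintype.card ι - 1) * ∏ i, s i := by
  classical
  have hle : ∏ _i ∈ univ.erase j, s j ≤ ∏ i ∈ univ.erase j, a * s i :=
    prod_le_prod (fun _ _ => (hs j).le) fun i _ => h j i
  rw [prod_mul_distrib, prod_const, prod_const, card_erase_of_mem (mem_univ j), card_univ] at hle
  rw [← mul_prod_erase univ s (mem_univ j),
    ← mul_pow_sub_one (Fintype.card_pos_iff.mpr ⟨j⟩).ne' (s j)]
  calc s j * s j ^ (Fintype.card ι - 1)
      ≤ s j * (a ^ (Fintype.card ι - 1) * ∏ i ∈ univ.erase j, s i) :=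
        mul_le_mul_of_nonneg_left hle (hs j).le
    _ = _ := by ring

theorem rpow_mul_rpow_pow {d : ℕ} (hd : 1 ≤ d) {a M : ℝ} (ha : 0 ≤ a) (hM : 0 ≤ M) :
    (a ^ (((d : ℝ) - 1) / d) * M ^ (1 / (d : ℝ))) ^ d = a ^ (d - 1) * M := by
  have hd0 : (d : ℝ) ≠ 0 := by positivity
  rw [mul_pow, ← Real.rpow_mul_natCast ha, ← Real.rpow_mul_natCast hM, div_mul_cancel₀ _ hd0,
    div_mul_cancel₀ _ hd0, Real.rpow_one, ← Nat.cast_pred hd, Real.rpow_natCast]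

/-- Quasi-isometry bound from condition-number and volume bounds: if
`σ₁/σ_d ≤ a` and `(P + 1/P)/2 ≤ c₂` with `P = Πσⱼ`, then all singular values
lie in `[1/Γ, Γ]` with `Γ = a^{(d-1)/d}·(c₂ + √(c₂²-1))^{1/d}`. -/
theorem quasi_isometry_bound
    {d : ℕ} (hd : 1 ≤ d)
    (σ : Fin d → ℝ) (hpos : ∀ j, 0 < σ j)
    (hord : ∀ i j : Fin d, i ≤ j → σ j ≤ σ i)
    (a : ℝ) (ha : 1 ≤ a)
    (hcond : σ ⟨0, by omega⟩ / σ ⟨d - 1, by omega⟩ ≤ a)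
    (c₂ : ℝ) (hc₂ : 1 ≤ c₂)
    (hvol : ((∏ j, σ j) + 1 / ∏ j, σ j) / 2 ≤ c₂)
    (Γ : ℝ)
    (hΓ : Γ = a ^ (((d:ℝ) - 1) / d) *
        (c₂ + Real.sqrt (c₂ ^ 2 - 1)) ^ (1 / (d:ℝ))) :
    ∀ j, 1 / Γ ≤ σ j ∧ σ j ≤ Γ := by
  have hratio : ∀ i j, σ i ≤ a * σ j := fun i j => by
    have h0 : σ i ≤ σ ⟨0, by omega⟩ := hord _ _ (Nat.zero_le _)
    have h1 : σ ⟨d - 1, by omega⟩ ≤ σ j := hord _ _ (Nat.le_sub_one_of_lt j.2)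
    rw [div_le_iff₀ (hpos _)] at hcond
    exact h0.trans (hcond.trans (mul_le_mul_of_nonneg_left h1 (by linarith)))
  have hratio_inv : ∀ i j, (σ i)⁻¹ ≤ a * (σ j)⁻¹ := fun i j => by
    rw [← div_eq_mul_inv, le_div_iff₀ (hpos j), inv_mul_le_iff₀ (hpos i), mul_comm]
    exact hratio j i
  have hP : 0 < ∏ j, σ j := prod_pos fun j _ => hpos j
  rw [one_div] at hvol
  have hPM := le_add_sqrt_of_add_inv_le hP hvol
  have hPM_inv := le_add_sqrt_of_add_inv_le (c := c₂) (inv_pos.mpr hP)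
    (by rwa [inv_inv, add_comm])
  have hM : 0 < c₂ + Real.sqrt (c₂ ^ 2 - 1) := hP.trans_le hPM
  have ha0 : 0 < a := by linarith
  have hΓ0 : 0 < Γ := by rw [hΓ]; positivity
  have hΓd := rpow_mul_rpow_pow hd ha0.le hM.le
  rw [← hΓ] at hΓd
  have hd0 : d ≠ 0 := by omega
  intro j
  constructor
  · have h := pow_card_le_of_ratio_le (fun i => inv_pos.mpr (hpos i)) hratio_inv j
    rw [Fintype.card_fin, prod_inv_distrib] at h
    rw [one_div, inv_le_comm₀ hΓ0 (hpos j)]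
    refine le_of_pow_le_pow_left₀ hd0 hΓ0.le (h.trans ?_)
    rw [hΓd]
    gcongr
  · have h := pow_card_le_of_ratio_le hpos hratio j
    rw [Fintype.card_fin] at h
    refine le_of_pow_le_pow_left₀ hd0 hΓ0.le (h.trans ?_)
    rw [hΓd]
    gcongr
end

section
/- Explicit 2D quasi-isometry bound for θ = 1/2. Let t ∈ (0,1) and let σ₁ ≥ σ₂ > 0 be real numbers (the singular values of a 2×2 Jacobian matrix with positive determinant). If (1/2)·(σ₁² + σ₂²)/(2σ₁σ₂) + (1/2)·(σ₁σ₂ + 1/(σ₁σ₂))/2 < 1/t, then, with Γ := (1 + √(1−t))²/t, one has σ₁ < Γ and σ₂ > 1/Γ; i.e. the quasi-isometry constant of the deformation is smaller than (1 + √(1−t))²/t. -/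
/-- A point where `t (x² + 1) < 2 x` lies below `(1 + √(1 - t))² / t`. -/
lemma lt_of_mul_sq_add_one_lt {t x : ℝ} (ht : t ∈ Set.Ioo (0 : ℝ) 1)
    (hx : t * (x ^ 2 + 1) < 2 * x) : x < (1 + Real.sqrt (1 - t)) ^ 2 / t := by
  obtain ⟨ht0, ht1⟩ := ht
  have hs : 0 ≤ Real.sqrt (1 - t) := Real.sqrt_nonneg _
  have hsq : Real.sqrt (1 - t) ^ 2 = 1 - t := Real.sq_sqrt (by linarith)
  generalize Real.sqrt (1 - t) = s at hs hsq ⊢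
  rw [lt_div_iff₀ ht0]
  by_contra! hle
  have hlow : 2 * s + s ^ 2 ≤ x * t - 1 := by linarith
  have hsquare : (2 * s + s ^ 2) ^ 2 ≤ (x * t - 1) ^ 2 :=
    pow_le_pow_left₀ (by positivity) hlow 2
  have hupper : (x * t - 1) ^ 2 < 1 - t ^ 2 := by
    linarith [mul_lt_mul_of_pos_left hx ht0]
  obtain rfl : t = 1 - s ^ 2 := by linarith
  have h3 : 0 ≤ s ^ 3 := by positivity
  have h4 : 0 ≤ s ^ 4 := by positivity
  linarith [sq_nonneg s]

/-- Explicit 2D quasi-isometry bound for `θ = 1/2`: if the combined distortion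
of a 2×2 Jacobian with singular values `σ₁ ≥ σ₂ > 0` is below `1/t`, then the
quasi-isometry constant is smaller than `(1 + √(1-t))²/t`. -/
theorem two_dim_quasi_isometry_bound
    (t : ℝ) (ht : t ∈ Set.Ioo (0:ℝ) 1)
    (σ₁ σ₂ : ℝ) (h21 : σ₂ ≤ σ₁) (h2pos : 0 < σ₂)
    (h : (1 / 2) * ((σ₁ ^ 2 + σ₂ ^ 2) / (2 * (σ₁ * σ₂))) +
        (1 / 2) * ((σ₁ * σ₂ + 1 / (σ₁ * σ₂)) / 2) < 1 / t)
    (Γ : ℝ) (hΓ : Γ = (1 + Real.sqrt (1 - t)) ^ 2 / t) :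
    σ₁ < Γ ∧ 1 / Γ < σ₂ := by
  obtain ⟨ht0, ht1⟩ := ht
  have h1pos : 0 < σ₁ := h2pos.trans_le h21
  have hprod : t * ((σ₁ ^ 2 + 1) * (σ₂ ^ 2 + 1)) < 4 * (σ₁ * σ₂) := by
    have hfactor : (1 / 2) * ((σ₁ ^ 2 + σ₂ ^ 2) / (2 * (σ₁ * σ₂))) +
        (1 / 2) * ((σ₁ * σ₂ + 1 / (σ₁ * σ₂)) / 2) =
        ((σ₁ ^ 2 + 1) * (σ₂ ^ 2 + 1)) / (4 * (σ₁ * σ₂)) := by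
      field_simp
      ring
    rw [hfactor, div_lt_div_iff₀ (by positivity) ht0] at h
    linarith
  have hσ₁ : t * (σ₁ ^ 2 + 1) < 2 * σ₁ := by
    have hc : 0 ≤ t * (σ₁ ^ 2 + 1) * (σ₂ - 1) ^ 2 := by positivity
    refine lt_of_mul_lt_mul_right (a := 2 * σ₂) ?_ (by positivity)
    linarith
  have hσ₂ : t * (σ₂ ^ 2 + 1) < 2 * σ₂ := by
    have hc : 0 ≤ t * (σ₂ ^ 2 + 1) * (σ₁ - 1) ^ 2 := by positivity
    refine lt_of_mul_lt_mul_right (a := 2 * σ₁) ?_ (by positivity)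
    linarith
  have hinv : t * ((1 / σ₂) ^ 2 + 1) < 2 * (1 / σ₂) := by
    calc t * ((1 / σ₂) ^ 2 + 1) = t * (σ₂ ^ 2 + 1) / σ₂ ^ 2 := by field_simp; ring
      _ < 2 * σ₂ / σ₂ ^ 2 := div_lt_div_of_pos_right hσ₂ (pow_pos h2pos 2)
      _ = 2 * (1 / σ₂) := by field_simp
  subst hΓ
  refine ⟨lt_of_mul_sq_add_one_lt ⟨ht0, ht1⟩ hσ₁, ?_⟩
  exact (one_div_lt h2pos (by positivity)).1 (lt_of_mul_sq_add_one_lt ⟨ht0, ht1⟩ hinv)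
end

section
/- Quasi-isometry bound for the symmetric Dirichlet energy. Let d ≥ 1, t ∈ (0,1), and let σ₁, …, σ_d > 0 be real numbers. If (1/(2d))·Σ_{j=1}^d (σ_j² + 1/σ_j²) < 1/t, then, with c₃ := 1 + d·(1−t)/t and Γ := c₃ + √(c₃² − 1), one has 1/Γ < σ_j < Γ for every j = 1, …, d. -/
open Finset

/-- A positive real whose sum with its inverse is less than `2 * c` is less than the larger root
of `x ^ 2 - 2 * c * x + 1`. -/
theorem lt_add_sqrt_of_add_inv_lt {y c : ℝ} (hy : 0 < y) (h : y + y⁻¹ < 2 * c) :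
    y < c + Real.sqrt (c ^ 2 - 1) := by
  have hmul : y * (y + y⁻¹) < y * (2 * c) := mul_lt_mul_of_pos_left h hy
  rw [mul_add, mul_inv_cancel₀ hy.ne'] at hmul
  have hsq : (y - c) ^ 2 < c ^ 2 - 1 := by linarith [sub_sq y c]
  linarith [Real.lt_sqrt_of_sq_lt hsq]

theorem two_le_add_inv_of_pos {y : ℝ} (hy : 0 < y) : 2 ≤ y + y⁻¹ := by
  have hmul : y * y⁻¹ = 1 := mul_inv_cancel₀ hy.ne'
  nlinarith [sq_nonneg (y - y⁻¹), inv_pos.mpr hy]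

/-- If all `n` summands are at least `a`, each one exceeds `a` by at most the total excess. -/
theorem le_sum_sub_of_forall_le {ι : Type*} [Fintype ι] {f : ι → ℝ} {a : ℝ}
    (hf : ∀ i, a ≤ f i) (j : ι) : f j ≤ ∑ i, f i - (Fintype.card ι - 1) * a := by
  have hle := Finset.single_le_sum (f := fun i => f i - a)
    (fun i _ => sub_nonneg.mpr (hf i)) (Finset.mem_univ j)
  simp only [Finset.sum_sub_distrib, Finset.sum_const, Finset.card_univ, nsmul_eq_mul] at hle
  linarith

/-- Quasi-isometry bound for the symmetric Dirichlet energy: if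
`(1/(2d))·Σ(σⱼ² + 1/σⱼ²) < 1/t` then every singular value lies strictly
within `(1/Γ, Γ)` with `Γ = c₃ + √(c₃² - 1)`, `c₃ = 1 + d(1-t)/t`. -/
theorem symmetric_dirichlet_quasi_isometry_bound
    {d : ℕ} (hd : 1 ≤ d)
    (t : ℝ) (ht : t ∈ Set.Ioo (0:ℝ) 1)
    (σ : Fin d → ℝ) (hpos : ∀ j, 0 < σ j)
    (h : (1 / (2 * (d:ℝ))) * ∑ j, (σ j ^ 2 + 1 / σ j ^ 2) < 1 / t)
    (c₃ : ℝ) (hc₃ : c₃ = 1 + (d:ℝ) * (1 - t) / t)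
    (Γ : ℝ) (hΓ : Γ = c₃ + Real.sqrt (c₃ ^ 2 - 1)) :
    ∀ j, 1 / Γ < σ j ∧ σ j < Γ := by
  obtain ⟨ht0, -⟩ := ht
  have hd0 : (0 : ℝ) < d := by exact_mod_cast hd
  simp only [one_div (σ _ ^ 2)] at h
  have hsum : ∑ i, (σ i ^ 2 + (σ i ^ 2)⁻¹) < 2 * (c₃ + (d - 1)) := by
    have hc : 2 * (c₃ + (d - 1)) = 1 / t * (2 * (d : ℝ)) := by
      rw [hc₃]
      field_simp
      ring
    rw [hc]
    rwa [one_div_mul_eq_div, div_lt_iff₀ (by positivity)] at h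
  intro j
  have hσ := hpos j
  have hs : 0 < σ j ^ 2 := by positivity
  have hj : σ j ^ 2 + (σ j ^ 2)⁻¹ < 2 * c₃ := by
    have hle := le_sum_sub_of_forall_le
      (fun i => two_le_add_inv_of_pos (pow_pos (hpos i) 2)) j
    rw [Fintype.card_fin] at hle
    linarith
  have hlt : σ j ^ 2 < Γ := hΓ ▸ lt_add_sqrt_of_add_inv_lt hs hj
  have hinv : (σ j ^ 2)⁻¹ < Γ :=
    hΓ ▸ lt_add_sqrt_of_add_inv_lt (inv_pos.mpr hs) (by rwa [inv_inv, add_comm])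
  have hΓ1 : 1 < Γ := by linarith [two_le_add_inv_of_pos hs]
  have hΓ2 : Γ < Γ ^ 2 := by nlinarith
  have hΓ0 : 0 < Γ := by linarith
  refine ⟨?_, lt_of_pow_lt_pow_left₀ 2 hΓ0.le (hlt.trans hΓ2)⟩
  rw [one_div, inv_lt_comm₀ hΓ0 hσ]
  exact lt_of_pow_lt_pow_left₀ 2 hΓ0.le (by rw [inv_pow]; exact hinv.trans hΓ2)
end
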